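/- Let β∖γ be a rook strip, α a partition of n, and L ⊆ Sₙ the set of permutations whose α-recording tableau is standard (equivalently, corresponding to LR-fillings of shape β∖γ, content α). If x < z in the Bruhat order with x, z ∈ L, then there exists a Bruhat cover x ⋖ y with y ∈ L and y ≤ z. -/

import Mathlib

open Equiv

/-! ### Permutations: adjacent transpositions, Coxeter length, Bruhat order -/

/-- `s` is an adjacent transposition `(i, i+1)` in `S_n` (values `0`-indexed). -/
def IsAdjTrans {n : ℕ} (s : Perm (Fin n)) : Prop :=
  ∃ (i : ℕ) (h : i + 1 < n), s = Equiv.swap ⟨i, Nat.lt_of_succ_lt h⟩ ⟨i + 1, h⟩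

/-- Coxeter length: the minimal number of adjacent transpositions in a factorization. -/
noncomputable def permLength {n : ℕ} (x : Perm (Fin n)) : ℕ :=
  sInf {k | ∃ l : List (Perm (Fin n)), l.length = k ∧ (∀ s ∈ l, IsAdjTrans s) ∧ l.prod = x}

/-- Strict Bruhat order: generated by `u < t * u` for transpositions `t`
increasing the length. -/
def BruhatLT {n : ℕ} (x z : Perm (Fin n)) : Prop :=
  Relation.TransGen
    (fun u v => ∃ t : Perm (Fin n), t.IsSwap ∧ v = t * u ∧ permLength u < permLength v) x z

/-- Bruhat order (reflexive version). -/
def BruhatLE {n : ℕ} (x z : Perm (Fin n)) : Prop := x = z ∨ BruhatLT x z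

/-! ### Partitions -/

/-- A partition: an antitone, finitely supported function `ℕ → ℕ`
(the part `αᵢ` of the paper is `f (i-1)`; rows are `0`-indexed). -/
structure Partn where
  f : ℕ → ℕ
  antitone' : Antitone f
  finite_supp : ∃ N, ∀ i, N ≤ i → f i = 0

/-- `p` is a partition of `n`. -/
def PartnOf (p : Partn) (n : ℕ) : Prop :=
  ∃ N, (∀ i, N ≤ i → p.f i = 0) ∧ ∑ i ∈ Finset.range N, p.f i = n

/-- The partial sum `α₁ + ⋯ + α_j` of the first `j` parts. -/
def psum (p : Partn) (j : ℕ) : ℕ := ∑ i ∈ Finset.range j, p.f i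

/-- The set of block boundaries `α₁, α₁+α₂, …` (`1`-indexed positions). -/
def Bdry (p : Partn) : Set ℕ := {m | ∃ j, 1 ≤ j ∧ m = psum p j}

/-- `S^α`: permutations whose values within each block of `α` occur in increasing
order of position.  Values are `0`-indexed: value `v` is the paper's value `v+1`,
and `v`, `v+1` lie in the same block iff `v+1 ∉ Bdry α`. -/
def SAset (α : Partn) {n : ℕ} (x : Perm (Fin n)) : Prop :=
  ∀ (v : ℕ) (h : v + 1 < n), (v + 1) ∉ Bdry α →
    x⁻¹ ⟨v, Nat.lt_of_succ_lt h⟩ < x⁻¹ ⟨v + 1, h⟩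

/-- Containment of partitions. -/
def PartnSub (γ β : Partn) : Prop := ∀ i, γ.f i ≤ β.f i

/-- The transpose (conjugate) partition: `β'_j = #{i : βᵢ ≥ j}` (columns `0`-indexed). -/
noncomputable def ptranspose (p : Partn) (j : ℕ) : ℕ := Set.ncard {i | j < p.f i}

/-- `β∖γ` is a vertical strip: `βᵢ ≤ γᵢ + 1` for all `i`. -/
def VertStrip (β γ : Partn) : Prop := ∀ i, β.f i ≤ γ.f i + 1

/-- `β∖γ` is a horizontal strip: `β'∖γ'` is a vertical strip. -/
def HorizStrip (β γ : Partn) : Prop := ∀ j, ptranspose β j ≤ ptranspose γ j + 1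

/-- A rook strip is a horizontal and vertical strip. -/
def RookStrip (β γ : Partn) : Prop := VertStrip β γ ∧ HorizStrip β γ

/-- The boxes of the skew diagram `β∖γ` (row, column), `0`-indexed. -/
def SkewCells (β γ : Partn) : Set (ℕ × ℕ) := {c | γ.f c.1 ≤ c.2 ∧ c.2 < β.f c.1}

/-! ### Fillings of skew diagrams -/

/-- A filling of the skew diagram `β∖γ` with content `α`: each box gets an entry
`≥ 1`, and there are `α_u` entries equal to `u` (the paper's `αᵤ` is `α.f (u-1)`). -/
structure SkFilling (α β γ : Partn) where
  entry : ℕ × ℕ → ℕ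
  zero_outside : ∀ c, c ∉ SkewCells β γ → entry c = 0
  pos_inside : ∀ c ∈ SkewCells β γ, 1 ≤ entry c
  content : ∀ u : ℕ, 1 ≤ u → Set.ncard {c ∈ SkewCells β γ | entry c = u} = α.f (u - 1)

/-- The Littlewood–Richardson conditions: rows weakly increase, columns strictly
increase, and the lattice permutation property holds. -/
def IsLRF {α β γ : Partn} (F : SkFilling α β γ) : Prop :=
  (∀ i j j' : ℕ, (i, j) ∈ SkewCells β γ → (i, j') ∈ SkewCells β γ → j ≤ j' →
      F.entry (i, j) ≤ F.entry (i, j')) ∧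
  (∀ i i' j : ℕ, (i, j) ∈ SkewCells β γ → (i', j) ∈ SkewCells β γ → i < i' →
      F.entry (i, j) < F.entry (i', j)) ∧
  (∀ u c : ℕ, 2 ≤ u →
      Set.ncard {p ∈ SkewCells β γ | c ≤ p.2 ∧ F.entry p = u} ≤
      Set.ncard {p ∈ SkewCells β γ | c ≤ p.2 ∧ F.entry p = u - 1})

/-- Row `i` of the partition `γ⁽ᵘ⁾`: the boxes of `γ` together with the boxes of
`β∖γ` whose entry is at most `u`. -/
noncomputable def regionRow {α β γ : Partn} (F : SkFilling α β γ) (u i : ℕ) : ℕ :=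
  γ.f i + Set.ncard {j | (i, j) ∈ SkewCells β γ ∧ F.entry (i, j) ≤ u}

/-- Dominance order on fillings: `Z ≤_dom X` iff `δ⁽ᵘ⁾ ≤_dom γ⁽ᵘ⁾` for every `u`. -/
def DomLE {α β γ : Partn} (Z X : SkFilling α β γ) : Prop :=
  ∀ u j : ℕ, ∑ i ∈ Finset.range j, regionRow Z u i ≤ ∑ i ∈ Finset.range j, regionRow X u i

/-- A single sorting swap: exchange two out-of-order entries within a row
(left entry bigger) or within a column (upper entry bigger). -/
def SortSwap (β γ : Partn) (W Z : ℕ × ℕ → ℕ) : Prop :=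
  ∃ p q : ℕ × ℕ, p ∈ SkewCells β γ ∧ q ∈ SkewCells β γ ∧
    ((p.1 = q.1 ∧ p.2 < q.2) ∨ (p.2 = q.2 ∧ p.1 < q.1)) ∧
    W q < W p ∧
    Z = Function.update (Function.update W p (W q)) q (W p)

/-- `Z` is obtained from `X` by a decreasing box move: two entries of `X` are
exchanged so that the smaller entry is in the lower position after the exchange,
and then rows and columns are re-sorted if necessary. -/
def BoxMove {α β γ : Partn} (X Z : SkFilling α β γ) : Prop :=
  ∃ p q : ℕ × ℕ, p ∈ SkewCells β γ ∧ q ∈ SkewCells β γ ∧ p.1 < q.1 ∧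
    X.entry p < X.entry q ∧
    Relation.ReflTransGen (SortSwap β γ)
      (Function.update (Function.update X.entry p (X.entry q)) q (X.entry p)) Z.entry

/-- The box order on LR-fillings: generated by decreasing box moves. -/
def LeBox {α β γ : Partn} (Z X : SkFilling α β γ) : Prop :=
  Relation.ReflTransGen (fun Y W => IsLRF Y ∧ IsLRF W ∧ BoxMove W Y) Z X

/-! ### Reading words and standardization -/

/-- The block (paper entry, `1`-indexed) containing the `0`-indexed value `v`. -/
noncomputable def blockIdx (α : Partn) (v : ℕ) : ℕ := sInf {u | v < psum α u}

/-- `e` enumerates the boxes of the rook strip `β∖γ` from top right to bottom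
left, i.e. in increasing order of rows. -/
def IsRowRead (β γ : Partn) {n : ℕ} (e : Fin n → ℕ × ℕ) : Prop :=
  (∀ k, e k ∈ SkewCells β γ) ∧ Function.Injective e ∧
  (∀ c ∈ SkewCells β γ, ∃ k, e k = c) ∧
  ∀ k l : Fin n, k < l → (e k).1 < (e l).1

/-- `e` enumerates the boxes of `β∖γ` column by column from left to right, each
column read from bottom to top (the reading order of the word `ω`). -/
def IsColRead (β γ : Partn) {n : ℕ} (e : Fin n → ℕ × ℕ) : Prop :=
  (∀ k, e k ∈ SkewCells β γ) ∧ Function.Injective e ∧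
  (∀ c ∈ SkewCells β γ, ∃ k, e k = c) ∧
  ∀ k l : Fin n, k < l →
    (e k).2 < (e l).2 ∨ ((e k).2 = (e l).2 ∧ (e l).1 < (e k).1)

/-- `p` is the standardization `π(F)` of the reading word of the filling `F`
with respect to the reading enumeration `e`: position `k` receives a value in the
block corresponding to the entry of the `k`-th box, and equal entries receive
their values in reading order. -/
def IsStdOf (α : Partn) {β γ : Partn} {n : ℕ} (F : SkFilling α β γ)
    (e : Fin n → ℕ × ℕ) (p : Perm (Fin n)) : Prop :=
  (∀ k : Fin n, blockIdx α (p k) = F.entry (e k)) ∧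
  ∀ k l : Fin n, k < l → F.entry (e k) = F.entry (e l) → p k < p l

/-- The `α`-recording tableau of `x` is standard: the entries `x⁻¹(psum α u + j)`
increase along rows and down columns of the shape `α` (rows `0`-indexed). -/
def RecStd (α : Partn) {n : ℕ} (x : Perm (Fin n)) : Prop :=
  (∀ u j j' : ℕ, j < j' → j' < α.f u →
    ∀ (h : psum α u + j < n) (h' : psum α u + j' < n),
      x⁻¹ ⟨psum α u + j, h⟩ < x⁻¹ ⟨psum α u + j', h'⟩) ∧
  (∀ u u' j : ℕ, u < u' → j < α.f u' →
    ∀ (h : psum α u + j < n) (h' : psum α u' + j < n),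
      x⁻¹ ⟨psum α u + j, h⟩ < x⁻¹ ⟨psum α u' + j, h'⟩)

/-- Covering relation of the box order on LR-fillings. -/
def CovBox {α β γ : Partn} (X Y : SkFilling α β γ) : Prop :=
  IsLRF X ∧ IsLRF Y ∧ LeBox X Y ∧ X ≠ Y ∧
    ∀ W, IsLRF W → LeBox X W → LeBox W Y → W = X ∨ W = Y

/-- The decreasing block `(i, i-1, …, 1)`. -/
def descBlock (i : ℕ) : List ℕ := ((List.range i).reverse).map (· + 1)

namespace BruhatAux

open Finset

variable {n : ℕ}

/-- Number of inversions. -/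
def inv (x : Perm (Fin n)) : ℕ :=
  ∑ a : Fin n, ∑ b : Fin n, if a < b ∧ x b < x a then 1 else 0

/-- Rank function. -/
def rk (x : Perm (Fin n)) (m v : Fin n) : ℕ :=
  ∑ a : Fin n, if a ≤ m ∧ v < x a then 1 else 0

lemma sum_split (f : Fin n → ℕ) {i l : Fin n} (h : i ≠ l) :
    ∑ a, f a = f i + f l + ∑ a ∈ (univ.erase i).erase l, f a := by
  rw [← Finset.add_sum_erase univ f (mem_univ i),
    ← Finset.add_sum_erase (univ.erase i) f (a := l) (by simp [h.symm]), add_assoc]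

lemma sum2_split (g : Fin n → Fin n → ℕ) {i l : Fin n} (h : i ≠ l) :
    ∑ a, ∑ b, g a b = (g i i + g i l + g l i + g l l)
      + ∑ m ∈ (univ.erase i).erase l, (g i m + g l m + g m i + g m l)
      + ∑ a ∈ (univ.erase i).erase l, ∑ b ∈ (univ.erase i).erase l, g a b := by
  rw [sum_split _ h]
  simp_rw [sum_split (fun b => g _ b) h]
  simp only [Finset.sum_add_distrib]
  ring

lemma inv_swap_aux (x : Perm (Fin n)) {i l : Fin n} (hil : i < l) (hx : x i < x l) :
    inv x + 1 ≤ inv (x * swap i l) ∧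
    ((∀ m, i < m → m < l → ¬ (x i < x m ∧ x m < x l)) → inv (x * swap i l) = inv x + 1) := by
  have hne : i ≠ l := hil.ne
  unfold inv
  rw [sum2_split (fun a b => if a < b ∧ x b < x a then 1 else 0) hne,
    sum2_split (fun a b => if a < b ∧ (x * swap i l) b < (x * swap i l) a then 1 else 0) hne]
  have hS : ∀ m ∈ (univ.erase i).erase l, m ≠ i ∧ m ≠ l := by
    intro m hm; simp at hm; exact ⟨hm.2, hm.1⟩
  have e1 : (x * swap i l) i = x l := by simp
  have e2 : (x * swap i l) l = x i := by simp
  have e3 : ∀ m, m ≠ i ∧ m ≠ l → (x * swap i l) m = x m := by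
    intro m hm; simp [swap_apply_of_ne_of_ne hm.1 hm.2]
  have hSS : (∑ a ∈ (univ.erase i).erase l, ∑ b ∈ (univ.erase i).erase l,
      if a < b ∧ (x * swap i l) b < (x * swap i l) a then 1 else 0) =
      ∑ a ∈ (univ.erase i).erase l, ∑ b ∈ (univ.erase i).erase l,
      if a < b ∧ x b < x a then 1 else 0 := by
    refine sum_congr rfl fun a ha => sum_congr rfl fun b hb => ?_
    rw [e3 a (hS a ha), e3 b (hS b hb)]
  rw [hSS]
  simp only [e1, e2]
  have hc : ¬ (l < i) := hil.not_gt
  have hc' : ¬ (x l < x i) := hx.not_gt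
  simp only [lt_irrefl, false_and, if_false, hil, hx, hc, hc', and_true, true_and, if_true, and_false]
  have key : ∀ m ∈ (univ.erase i).erase l,
      ((if i < m ∧ x m < x i then 1 else 0) + (if l < m ∧ x m < x l then 1 else 0)
        + (if m < i ∧ x i < x m then 1 else 0) + (if m < l ∧ x l < x m then 1 else 0) : ℕ) ≤
      ((if i < m ∧ (x * swap i l) m < x l then 1 else 0)
        + (if l < m ∧ (x * swap i l) m < x i then 1 else 0)
        + (if m < i ∧ x l < (x * swap i l) m then 1 else 0)
        + (if m < l ∧ x i < (x * swap i l) m then 1 else 0)) := by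
    intro m hm
    have h := hS m hm
    rw [e3 m h]
    have h1 : x m ≠ x i := fun e => h.1 (x.injective e)
    have h2 : x m ≠ x l := fun e => h.2 (x.injective e)
    split_ifs <;> omega
  have key2 : (∀ m, i < m → m < l → ¬ (x i < x m ∧ x m < x l)) → ∀ m ∈ (univ.erase i).erase l,
      ((if i < m ∧ (x * swap i l) m < x l then 1 else 0)
        + (if l < m ∧ (x * swap i l) m < x i then 1 else 0)
        + (if m < i ∧ x l < (x * swap i l) m then 1 else 0)
        + (if m < l ∧ x i < (x * swap i l) m then 1 else 0) : ℕ) =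
      ((if i < m ∧ x m < x i then 1 else 0) + (if l < m ∧ x m < x l then 1 else 0)
        + (if m < i ∧ x i < x m then 1 else 0) + (if m < l ∧ x l < x m then 1 else 0)) := by
    intro hno m hm
    have h := hS m hm
    rw [e3 m h]
    have h0 := hno m
    have h1 : x m ≠ x i := fun e => h.1 (x.injective e)
    have h2 : x m ≠ x l := fun e => h.2 (x.injective e)
    split_ifs <;> omega
  constructor
  · have := sum_le_sum key
    omega
  · intro hno
    rw [sum_congr rfl (key2 hno)]
    omega

lemma inv_swap_lt (x : Perm (Fin n)) {i l : Fin n} (hil : i < l) (hx : x i < x l) :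
    inv x < inv (x * swap i l) := (inv_swap_aux x hil hx).1

lemma inv_swap_cover (x : Perm (Fin n)) {i l : Fin n} (hil : i < l) (hx : x i < x l)
    (h : ∀ m, i < m → m < l → ¬ (x i < x m ∧ x m < x l)) :
    inv (x * swap i l) = inv x + 1 := (inv_swap_aux x hil hx).2 h

lemma inv_one : inv (1 : Perm (Fin n)) = 0 := by
  unfold inv
  refine sum_eq_zero fun a _ => sum_eq_zero fun b _ => ?_
  rw [if_neg]
  rintro ⟨h1, h2⟩
  simp at h2
  omega

/-- Left multiplication by an adjacent transposition, ascending case. -/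
lemma inv_adj (x : Perm (Fin n)) {v w : Fin n} (hvw : (w : ℕ) = v + 1)
    (h : x⁻¹ v < x⁻¹ w) : inv (swap v w * x) = inv x + 1 := by
  have e : swap v w * x = x * swap (x⁻¹ v) (x⁻¹ w) := by
    rw [mul_swap_eq_swap_mul]; simp
  rw [e]
  apply inv_swap_cover x h
  · simp; omega
  · intro m _ _
    simp
    omega

lemma inv_adj' (x : Perm (Fin n)) {v w : Fin n} (hvw : (w : ℕ) = v + 1)
    (h : x⁻¹ w < x⁻¹ v) : inv (swap v w * x) + 1 = inv x := by
  have := inv_adj (swap v w * x) hvw (by simpa using h)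
  rw [← this, ← mul_assoc, swap_mul_self, one_mul]

lemma inv_prod_le (l : List (Perm (Fin n))) (hl : ∀ s ∈ l, IsAdjTrans s) :
    inv l.prod ≤ l.length := by
  induction l with
  | nil => simp [inv_one]
  | cons s t ih =>
    obtain ⟨i, hi, hs⟩ := hl s (by simp)
    have h := ih (fun s hs => hl s (by simp [hs]))
    rw [List.prod_cons, List.length_cons, hs]
    rcases lt_trichotomy (t.prod⁻¹ ⟨i, Nat.lt_of_succ_lt hi⟩) (t.prod⁻¹ ⟨i + 1, hi⟩) with h1 | h1 | h1
    · rw [inv_adj _ rfl h1]; omega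
    · have := t.prod⁻¹.injective h1
      simp at this
    · have := inv_adj' _ (v := ⟨i, Nat.lt_of_succ_lt hi⟩) (w := ⟨i + 1, hi⟩) rfl h1
      omega

lemma exists_desc (x : Perm (Fin n)) (hx : x ≠ 1) :
    ∃ (i : ℕ) (h : i + 1 < n), x⁻¹ ⟨i + 1, h⟩ < x⁻¹ ⟨i, Nat.lt_of_succ_lt h⟩ := by
  by_contra hcon
  push Not at hcon
  apply hx
  cases n with
  | zero => exact Subsingleton.elim _ _
  | succ n =>
    have hm : StrictMono (x⁻¹ : Perm (Fin (n+1))) := by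
      rw [Fin.strictMono_iff_lt_succ]
      intro i
      refine lt_of_le_of_ne (hcon i (by omega)) ?_
      intro h
      have := x⁻¹.injective h
      simp [Fin.ext_iff] at this
    have hr : (x⁻¹ : Perm (Fin (n+1))) = 1 := by
      have h2 := Subsingleton.elim (StrictMono.orderIsoOfSurjective _ hm x⁻¹.surjective)
        (OrderIso.refl (Fin (n+1)))
      ext a
      have := congrArg (fun f : Fin (n+1) ≃o Fin (n+1) => (f a : ℕ)) h2
      simpa using this
    exact inv_eq_one.mp hr

lemma exists_word (N : ℕ) (x : Perm (Fin n)) (hN : inv x = N) :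
    ∃ l : List (Perm (Fin n)), l.length = N ∧ (∀ s ∈ l, IsAdjTrans s) ∧ l.prod = x := by
  induction N using Nat.strong_induction_on generalizing x with
  | _ N ih =>
    by_cases hx : x = 1
    · subst hx
      rw [inv_one] at hN
      exact ⟨[], by simp [← hN]⟩
    · obtain ⟨i, hi, hd⟩ := exists_desc x hx
      have h := inv_adj' x (v := ⟨i, Nat.lt_of_succ_lt hi⟩) (w := ⟨i + 1, hi⟩) rfl hd
      obtain ⟨l, h1, h2, h3⟩ := ih _ (by omega)
        (swap ⟨i, Nat.lt_of_succ_lt hi⟩ ⟨i + 1, hi⟩ * x) rfl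
      refine ⟨swap ⟨i, Nat.lt_of_succ_lt hi⟩ ⟨i + 1, hi⟩ :: l, ?_, ?_, ?_⟩
      · simp; omega
      · intro s hs
        rcases List.mem_cons.mp hs with rfl | hs
        · exact ⟨i, hi, rfl⟩
        · exact h2 s hs
      · rw [List.prod_cons, h3, ← mul_assoc, swap_mul_self, one_mul]

lemma permLength_eq (x : Perm (Fin n)) : permLength x = inv x := by
  unfold permLength
  apply le_antisymm
  · exact Nat.sInf_le (exists_word _ x rfl)
  · obtain ⟨l, h1, h2, h3⟩ := Nat.sInf_mem
      (s := {k | ∃ l : List (Perm (Fin n)), l.length = k ∧ (∀ s ∈ l, IsAdjTrans s) ∧ l.prod = x})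
      ⟨_, exists_word _ x rfl⟩
    rw [← h1, ← h3]
    exact inv_prod_le l h2

lemma rk_swap (x : Perm (Fin n)) {i l : Fin n} (hil : i < l) (hx : x i < x l) (m v : Fin n) :
    rk (x * swap i l) m v = rk x m v + if i ≤ m ∧ m < l ∧ x i ≤ v ∧ v < x l then 1 else 0 := by
  have hne : i ≠ l := hil.ne
  unfold rk
  rw [sum_split _ hne, sum_split (fun a => if a ≤ m ∧ v < x a then 1 else 0) hne]
  have e1 : (x * swap i l) i = x l := by simp
  have e2 : (x * swap i l) l = x i := by simp
  have hS : (∑ a ∈ (univ.erase i).erase l, if a ≤ m ∧ v < (x * swap i l) a then 1 else 0)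
      = ∑ a ∈ (univ.erase i).erase l, if a ≤ m ∧ v < x a then 1 else 0 := by
    refine sum_congr rfl fun a ha => ?_
    simp at ha
    simp [swap_apply_of_ne_of_ne ha.2 ha.1]
  rw [hS, e1, e2]
  split_ifs <;> omega

/-- An edge of the Bruhat graph. -/
lemma edge (x : Perm (Fin n)) {i l : Fin n} (hil : i < l) (hx : x i < x l) :
    BruhatLT x (x * swap i l) := by
  refine Relation.TransGen.single ⟨swap (x i) (x l), ⟨x i, x l, hx.ne, rfl⟩, ?_, ?_⟩
  · rw [mul_swap_eq_swap_mul]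
  · rw [permLength_eq, permLength_eq]
    exact inv_swap_lt x hil hx

lemma rk_le_of_lt {x z : Perm (Fin n)} (h : BruhatLT x z) :
    (∀ m v, rk x m v ≤ rk z m v) ∧ inv x < inv z := by
  have step : ∀ u v : Perm (Fin n),
      (∃ t : Perm (Fin n), t.IsSwap ∧ v = t * u ∧ permLength u < permLength v) →
      (∀ a b, rk u a b ≤ rk v a b) ∧ inv u < inv v := by
    rintro u v ⟨t, ⟨p, q, hpq, rfl⟩, rfl, hl⟩
    rw [permLength_eq, permLength_eq] at hl
    refine ⟨?_, hl⟩
    have main : ∀ p q : Fin n, u⁻¹ p < u⁻¹ q → inv u < inv (swap p q * u) →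
        ∀ a b, rk u a b ≤ rk (swap p q * u) a b := by
      intro p q hpq hl a b
      have e : swap p q * u = u * swap (u⁻¹ p) (u⁻¹ q) := by
        rw [mul_swap_eq_swap_mul]; simp
      rcases lt_trichotomy p q with h | h | h
      · rw [e, rk_swap u hpq (by simpa using h)]; omega
      · subst h; simp at hpq
      · exfalso
        have h3 := inv_swap_lt (swap p q * u) hpq (by simpa using h)
        rw [e, mul_assoc, swap_mul_self, mul_one, ← e] at h3
        omega
    rcases lt_trichotomy (u⁻¹ p) (u⁻¹ q) with h | h | h
    · exact main p q h hl
    · exact absurd (u⁻¹.injective h) hpq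
    · rw [swap_comm] at hl ⊢
      exact main q p h hl
  induction h with
  | single h => exact step _ _ h
  | tail _ h ih =>
    have := step _ _ h
    exact ⟨fun m v => (ih.1 m v).trans (this.1 m v), ih.2.trans this.2⟩

/-- The main construction. -/
lemma construct {x z : Perm (Fin n)} (hne : x ≠ z) (hr : ∀ m v, rk x m v ≤ rk z m v) :
    ∃ k i l : Fin n, (∀ a, a < k → x a = z a) ∧ x l = z k ∧ k ≤ i ∧ i < l ∧ x i < x l ∧
      (∀ m, k ≤ m → m < l → ¬ (x i < x m ∧ x m < x l)) ∧
      ∀ m v, rk (x * swap i l) m v ≤ rk z m v := by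
  classical
  have hD : (univ.filter fun a => x a ≠ z a).Nonempty := by
    by_contra hc
    rw [not_nonempty_iff_eq_empty, filter_eq_empty_iff] at hc
    exact hne (Equiv.ext fun a => by simpa using hc (mem_univ a))
  obtain ⟨k, hk, hmin⟩ := exists_min_image _ id hD
  simp only [mem_filter, mem_univ, true_and, id] at hk hmin
  have hag : ∀ a, a < k → x a = z a := by
    intro a ha
    by_contra hc
    exact absurd (hmin a hc) (not_le.mpr ha)
  have hkl : x k < z k := by
    refine lt_of_le_of_ne ?_ hk
    by_contra hc
    push Not at hc
    have h := hr k (z k)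
    refine absurd h (not_le.mpr ?_)
    unfold rk
    refine sum_lt_sum (fun a _ => ?_) ⟨k, mem_univ _, ?_⟩
    · rcases lt_trichotomy a k with h | h | h
      · rw [hag a h]
      · subst h; simp
      · simp [h.not_ge]
    · simp [hc]
  obtain ⟨l, hl⟩ : ∃ l, x l = z k := x.surjective _
  have hlk : k < l := by
    rcases lt_trichotomy k l with h | h | h
    · exact h
    · subst h; exact absurd hl hk
    · have := hag l h
      rw [hl] at this
      exact absurd (z.injective this) h.ne'
  obtain ⟨i, hi, hmax⟩ := exists_max_image (univ.filter fun a => k ≤ a ∧ a < l ∧ x a < x l) x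
    ⟨k, by simp [hlk, hl, hkl]⟩
  simp only [mem_filter, mem_univ, true_and] at hi hmax
  have hno : ∀ m, k ≤ m → m < l → ¬ (x i < x m ∧ x m < x l) := by
    rintro m h1 h2 ⟨h3, h4⟩
    exact absurd (hmax m ⟨h1, h2, h4⟩) (not_le.mpr h3)
  refine ⟨k, i, l, hag, hl, hi.1, hi.2.1, hi.2.2, hno, ?_⟩
  intro m v
  rw [rk_swap x hi.2.1 hi.2.2]
  split_ifs with hc
  · obtain ⟨h1, h2, h3, h4⟩ := hc
    have split : ∀ w : Perm (Fin n), rk w m v = rk w m (x l) +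
        ∑ a, if a ≤ m ∧ v < w a ∧ w a ≤ x l then 1 else 0 := by
      intro w
      unfold rk
      rw [← sum_add_distrib]
      refine sum_congr rfl fun a _ => ?_
      split_ifs <;> omega
    rw [split x, split z]
    have h5 := hr m (x l)
    have h6 : (∑ a, if a ≤ m ∧ v < x a ∧ x a ≤ x l then 1 else 0) <
        ∑ a, if a ≤ m ∧ v < z a ∧ z a ≤ x l then 1 else 0 := by
      have hx0 : ∀ a, k ≤ a → ¬ (a ≤ m ∧ v < x a ∧ x a ≤ x l) := by
        rintro a ha ⟨g1, g2, g3⟩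
        have g4 : a < l := lt_of_le_of_lt g1 h2
        exact hno a ha g4 ⟨lt_of_le_of_lt h3 g2,
          lt_of_le_of_ne g3 fun e => g4.ne (x.injective e)⟩
      refine sum_lt_sum (fun a _ => ?_) ⟨k, mem_univ _, ?_⟩
      · rcases lt_or_ge a k with h | h
        · rw [hag a h]
        · rw [if_neg (hx0 a h)]; omega
      · rw [if_neg (hx0 k le_rfl), if_pos ⟨hi.1.trans h1, hl ▸ h4, hl ▸ le_rfl⟩]
        omega
    omega
  · simpa using hr m v

lemma inv_le (x : Perm (Fin n)) : inv x ≤ n * n := by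
  unfold inv
  calc _ ≤ ∑ a : Fin n, ∑ b : Fin n, 1 := by
        refine sum_le_sum fun a _ => sum_le_sum fun b _ => ?_
        split_ifs <;> omega
    _ = n * n := by simp

lemma le_of_rk (N : ℕ) (x z : Perm (Fin n)) (hN : n * n - inv x = N)
    (hr : ∀ m v, rk x m v ≤ rk z m v) : BruhatLE x z := by
  induction N using Nat.strong_induction_on generalizing x with
  | _ N ih =>
    by_cases hne : x = z
    · exact Or.inl hne
    · obtain ⟨k, i, l, _, _, _, hil, hx, _, hy⟩ := construct hne hr
      have h1 := inv_swap_lt x hil hx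
      have h2 := inv_le (x * swap i l)
      right
      rcases ih _ (by omega) (x * swap i l) rfl hy with h | h
      · rw [← h]; exact edge x hil hx
      · exact (edge x hil hx).trans h

lemma psum_succ (α : Partn) (u : ℕ) : psum α (u + 1) = psum α u + α.f u := by
  unfold psum; rw [sum_range_succ]

lemma psum_mono (α : Partn) : Monotone (psum α) :=
  monotone_nat_of_le_succ fun u => by rw [psum_succ]; omega

lemma exists_cell (α : Partn) (hα : PartnOf α n) (v : ℕ) (hv : v < n) :
    ∃ u j, j < α.f u ∧ v = psum α u + j := by
  classical
  obtain ⟨N, _, hN⟩ := hα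
  have hex : ∃ u, v < psum α (u + 1) :=
    ⟨N, lt_of_lt_of_le (by rw [← hN] at hv; exact hv) (psum_mono α (Nat.le_succ N))⟩
  have h1 := Nat.find_spec hex
  have h2 : psum α (Nat.find hex) ≤ v := by
    rcases Nat.eq_zero_or_pos (Nat.find hex) with h | h
    · rw [h]; simp [psum]
    · have := Nat.find_min hex (m := Nat.find hex - 1) (by omega)
      rw [Nat.sub_add_cancel h] at this
      omega
  rw [psum_succ] at h1
  exact ⟨Nat.find hex, v - psum α (Nat.find hex), by omega, by omega⟩

/-- Rows/columns relation on values. -/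
def Rel (α : Partn) (V W : ℕ) : Prop :=
  (∃ u j j', j < j' ∧ j' < α.f u ∧ V = psum α u + j ∧ W = psum α u + j') ∨
  (∃ u u' j, u < u' ∧ j < α.f u' ∧ V = psum α u + j ∧ W = psum α u' + j)

lemma Rel.lt {α : Partn} {V W : ℕ} (h : Rel α V W) : V < W := by
  rcases h with ⟨u, j, j', h1, h2, rfl, rfl⟩ | ⟨u, u', j, h1, h2, rfl, rfl⟩
  · omega
  · have h3 := psum_mono α (show u + 1 ≤ u' from h1)
    have h4 := α.antitone' h1.le
    rw [psum_succ] at h3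
    omega

lemma recStd_iff (α : Partn) (x : Perm (Fin n)) :
    RecStd α x ↔ ∀ V W : Fin n, Rel α V W → x⁻¹ V < x⁻¹ W := by
  constructor
  · rintro ⟨hr, hc⟩ ⟨V, hV⟩ ⟨W, hW⟩ h
    rcases h with ⟨u, j, j', h1, h2, h3, h4⟩ | ⟨u, u', j, h1, h2, h3, h4⟩
    · simp only at h3 h4
      subst h3 h4
      exact hr u j j' h1 h2 hV hW
    · simp only at h3 h4
      subst h3 h4
      exact hc u u' j h1 h2 hV hW
  · intro h
    exact ⟨fun u j j' h1 h2 hV hW => h _ _ (Or.inl ⟨u, j, j', h1, h2, rfl, rfl⟩),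
      fun u u' j h1 h2 hV hW => h _ _ (Or.inr ⟨u, u', j, h1, h2, rfl, rfl⟩)⟩

/-- Transitive comparison of values valid for all standard tableaux. -/
lemma rel_between (α : Partn) (hα : PartnOf α n) (Q R V : ℕ) (hV : V < n)
    (h : Rel α Q V) (h1 : Q < R) (h2 : R < V) :
    Relation.TransGen (fun a b => a < n ∧ b < n ∧ Rel α a b) Q R ∨
    Relation.TransGen (fun a b => a < n ∧ b < n ∧ Rel α a b) R V := by
  rcases h with ⟨u, j, j', g1, g2, rfl, rfl⟩ | ⟨q, q', j, g1, g2, rfl, rfl⟩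
  · right
    exact .single ⟨by omega, by omega,
      Or.inl ⟨u, R - psum α u, j', by omega, by omega, by omega, rfl⟩⟩
  · obtain ⟨r, c, hc, rfl⟩ := exists_cell α hα R (by omega)
    have hqr : q ≤ r := by
      by_contra hcon
      have := psum_mono α (show r + 1 ≤ q by omega)
      rw [psum_succ] at this
      omega
    have hrq : r ≤ q' := by
      by_contra hcon
      have := psum_mono α (show q' + 1 ≤ r by omega)
      rw [psum_succ] at this
      omega
    rcases le_or_gt c j with hcj | hcj
    · right
      rcases hrq.lt_or_eq with hlt | rfl
      · rcases hcj.lt_or_eq with hcj | rfl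
        · refine .head (b := psum α q' + c) ⟨by omega, by omega,
            Or.inr ⟨r, q', c, hlt, by omega, rfl, rfl⟩⟩
            (.single ⟨by omega, by omega, Or.inl ⟨q', c, j, hcj, g2, rfl, rfl⟩⟩)
        · exact .single ⟨by omega, by omega, Or.inr ⟨r, q', c, hlt, g2, rfl, rfl⟩⟩
      · exact .single ⟨by omega, by omega, Or.inl ⟨r, c, j, by omega, g2, rfl, rfl⟩⟩
    · left
      rcases hqr.lt_or_eq with hlt | rfl
      · exact .head (b := psum α r + j) ⟨by omega, by omega,
            Or.inr ⟨q, r, j, hlt, by omega, rfl, rfl⟩⟩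
            (.single ⟨by omega, by omega, Or.inl ⟨r, j, c, hcj, hc, rfl, rfl⟩⟩)
      · exact .single ⟨by omega, by omega, Or.inl ⟨q, j, c, hcj, hc, rfl, rfl⟩⟩

lemma transGen_lt {α : Partn} {x : Perm (Fin n)} (hx : RecStd α x) {V W : ℕ}
    (h : Relation.TransGen (fun a b => a < n ∧ b < n ∧ Rel α a b) V W) :
    ∃ (hV : V < n) (hW : W < n), x⁻¹ ⟨V, hV⟩ < x⁻¹ ⟨W, hW⟩ := by
  rw [recStd_iff] at hx
  induction h with
  | single h => exact ⟨h.1, h.2.1, hx _ _ h.2.2⟩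
  | tail _ h ih =>
    obtain ⟨hV, hW, ih⟩ := ih
    exact ⟨hV, h.2.1, ih.trans (hx ⟨_, hW⟩ ⟨_, h.2.1⟩ h.2.2)⟩

lemma recStd_swap (α : Partn) (hα : PartnOf α n) (x z : Perm (Fin n))
    (hx : RecStd α x) (hz : RecStd α z) {k i l : Fin n} (hag : ∀ a, a < k → x a = z a)
    (hl : x l = z k) (hki : k ≤ i) (hil : i < l) (hxil : x i < x l)
    (hno : ∀ m, k ≤ m → m < l → ¬ (x i < x m ∧ x m < x l)) :
    RecStd α (x * swap i l) := by
  have hpre : ∀ V : Fin n, z⁻¹ V < k → x⁻¹ V < k := by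
    intro V hV
    have := hag _ hV
    have e : x⁻¹ V = z⁻¹ V := by
      rw [Perm.inv_eq_iff_eq, this]; simp
    rwa [e]
  have hx' := (recStd_iff α x).mp hx
  have hz' := (recStd_iff α z).mp hz
  have hzl : z⁻¹ (x l) = k := by rw [hl]; simp
  rw [recStd_iff]
  intro V W hVW
  -- positions of `V` and `W` in `x`
  obtain ⟨a, rfl⟩ := x.surjective V
  obtain ⟨b, rfl⟩ := x.surjective W
  have hab : a < b := by simpa using hx' _ _ hVW
  have ez : ∀ a : Fin n, (x * swap i l)⁻¹ (x a) = swap i l a := by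
    intro a; simp [mul_inv_rev]
  rw [ez, ez]
  have hbl : b = l → a < k := by
    rintro rfl
    have h1 := hz' _ _ hVW
    rw [hzl] at h1
    simpa using hpre _ h1
  by_cases hbL : b = l
  · have h1 := hbl hbL
    subst hbL
    rw [swap_apply_right, swap_apply_of_ne_of_ne (by omega) (by omega)]
    omega
  by_cases hbI : b = i
  · subst hbI
    rw [swap_apply_left, swap_apply_of_ne_of_ne (by omega) (by omega)]
    omega
  rw [swap_apply_of_ne_of_ne hbI hbL]
  by_cases haL : a = l
  · subst haL
    rw [swap_apply_right]; omega
  by_cases haI : a = i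
  · subst haI
    rw [swap_apply_left]
    by_contra hcon
    have hbl' : b < l := by omega
    have hlt : x a < x b := hVW.lt
    have hlt2 : x l < x b := by
      have h1 := hno b (by omega) hbl'
      have h2 : x b ≠ x l := fun e => hbL (x.injective e)
      omega
    rcases rel_between α hα (x a) (x l) (x b) (x b).2 hVW hxil hlt2 with h | h
    · obtain ⟨_, _, h3⟩ := transGen_lt hz h
      simp only [Fin.eta] at h3
      rw [hzl] at h3
      have := hpre _ h3
      simp at this
      omega
    · obtain ⟨_, _, h3⟩ := transGen_lt hx h
      simp at h3
      omega
  rwa [swap_apply_of_ne_of_ne haI haL]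

end BruhatAux

/-- if `x < z` in Bruhat order with `x, z ∈ L` (standard
`α`-recording tableaux), then there is a cover `x ⋖ y` with `y ∈ L` and `y ≤ z`. -/
theorem stmt10 (n : ℕ) (α : Partn) (hα : PartnOf α n) (x z : Perm (Fin n))
    (hx : RecStd α x) (hz : RecStd α z) (hxz : BruhatLT x z) :
    ∃ y : Perm (Fin n), RecStd α y ∧ BruhatLT x y ∧
      permLength y = permLength x + 1 ∧ BruhatLE y z := by
  have h := BruhatAux.rk_le_of_lt hxz
  have hne : x ≠ z := by
    rintro rfl
    exact absurd h.2 (lt_irrefl _)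
  obtain ⟨k, i, l, hag, hl, hki, hil, hx1, hno, hy⟩ := BruhatAux.construct hne h.1
  refine ⟨x * swap i l, BruhatAux.recStd_swap α hα x z hx hz hag hl hki hil hx1 hno,
    BruhatAux.edge x hil hx1, ?_, BruhatAux.le_of_rk _ _ z rfl hy⟩
  rw [BruhatAux.permLength_eq, BruhatAux.permLength_eq]
  exact BruhatAux.inv_swap_cover x hil hx1 fun m h1 h2 => hno m (hki.trans h1.le) h2
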